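/- The BV operator ∂ is a second-order operator with respect to the wedge product in the following sense: the BV bracket satisfies the graded Leibniz rule {A, B∧C} = {A,B}∧C + (−1)^{(p+1)q} B∧{A,C} for all homogeneous A ∈ PV^p, B ∈ PV^q, C ∈ PV. -/

import Mathlib

open MvPolynomial TensorProduct

noncomputable section

/-- The exterior algebra `⋀(ℂ^N)` on the generators `θ₁,…,θ_N`. -/
abbrev ExtN (N : ℕ) := ExteriorAlgebra ℂ (Fin N → ℂ)

/-- Polynomial polyvector fields `PV = R ⊗ ⋀(ℂ^N)`. -/
abbrev PV (N : ℕ) := MvPolynomial (Fin N) ℂ ⊗[ℂ] ExtN N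

/-- Contraction (interior product) with the `k`-th dual covector. -/
def contr {N : ℕ} (k : Fin N) : ExtN N →ₗ[ℂ] ExtN N :=
  CliffordAlgebra.contractLeft (LinearMap.proj k)

/-- The BV operator `∂(α ⊗ ω) = Σ_k (∂α/∂x_k) ⊗ ι_k(ω)`. -/
def bv (N : ℕ) : PV N →ₗ[ℂ] PV N :=
  ∑ k : Fin N, TensorProduct.map (pderiv k).toLinearMap (contr k)

/-- The `p`-th exterior power, as a submodule of the exterior algebra. -/
def grE (N p : ℕ) : Submodule ℂ (ExtN N) :=
  (LinearMap.range (ExteriorAlgebra.ι ℂ : (Fin N → ℂ) →ₗ[ℂ] ExtN N)) ^ p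

/-- The graded piece `PV^p = R ⊗ ⋀^p(ℂ^N)` of `PV`. -/
def PVgr (N p : ℕ) : Submodule ℂ (PV N) :=
  LinearMap.range (TensorProduct.map (LinearMap.id : MvPolynomial (Fin N) ℂ →ₗ[ℂ] _)
    (grE N p).subtype)

/-- The BV bracket `{A,B} = (−1)^p ∂(A∧B) − (−1)^p ∂(A)∧B − A∧∂(B)` of `A ∈ PV^p` with
`B ∈ PV`. -/
def bvBracket {N : ℕ} (p : ℕ) (A B : PV N) : PV N :=
  ((-1 : ℂ) ^ p) • bv N (A * B) - ((-1 : ℂ) ^ p) • (bv N A * B) - A * bv N B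

theorem bvaux_mul {N : ℕ} (k : Fin N) (p : ℕ) (w : ExtN N) (hw : w ∈ grE N p) (h : ExtN N) :
    contr k (w * h) = contr k w * h + ((-1 : ℂ) ^ p) • (w * contr k h) := by
  unfold grE at hw
  induction hw using Submodule.pow_induction_on_left' with
  | algebraMap r =>
    simp [contr, Algebra.algebraMap_eq_smul_one]
  | add x y i hx hy h1 h2 =>
    simp only [add_mul, map_add, h1, h2, smul_add]; abel
  | mem_mul m hm i x hx ih =>
    obtain ⟨v, rfl⟩ := hm
    have key : ∀ y : ExtN N, contr k (ExteriorAlgebra.ι ℂ v * y)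
        = (v k) • y - ExteriorAlgebra.ι ℂ v * contr k y := fun y =>
      CliffordAlgebra.contractLeft_ι_mul (Q := (0 : QuadraticForm ℂ (Fin N → ℂ)))
        (d := LinearMap.proj k) v y
    rw [mul_assoc, key, key, ih]
    simp only [mul_add, sub_mul, mul_smul_comm, smul_mul_assoc, mul_assoc, pow_succ]
    module

theorem bvaux_ι_comm {N : ℕ} (q : ℕ) (v : Fin N → ℂ) (h : ExtN N) (hh : h ∈ grE N q) :
    ExteriorAlgebra.ι ℂ v * h = ((-1 : ℂ) ^ q) • (h * ExteriorAlgebra.ι ℂ v) := by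
  unfold grE at hh
  induction hh using Submodule.pow_induction_on_left' with
  | algebraMap r => simp [Algebra.algebraMap_eq_smul_one]
  | add x y i hx hy h1 h2 => simp only [add_mul, mul_add, h1, h2, smul_add]
  | mem_mul m hm i x hx ih =>
    obtain ⟨u, rfl⟩ := hm
    have e : ExteriorAlgebra.ι ℂ v * ExteriorAlgebra.ι ℂ u
        = - (ExteriorAlgebra.ι ℂ u * ExteriorAlgebra.ι ℂ v) :=
      eq_neg_of_add_eq_zero_left (ExteriorAlgebra.ι_add_mul_swap v u)
    rw [← mul_assoc, e, neg_mul, mul_assoc, ih, pow_succ, mul_smul_comm, mul_assoc]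
    module

theorem bvaux_comm {N : ℕ} (p q : ℕ) (w : ExtN N) (hw : w ∈ grE N p) (h : ExtN N)
    (hh : h ∈ grE N q) : w * h = ((-1 : ℂ) ^ (p * q)) • (h * w) := by
  unfold grE at hw
  induction hw using Submodule.pow_induction_on_left' with
  | algebraMap r => simp [Algebra.algebraMap_eq_smul_one]
  | add x y i hx hy h1 h2 => simp only [add_mul, mul_add, h1, h2, smul_add]
  | mem_mul m hm i x hx ih =>
    obtain ⟨u, rfl⟩ := hm
    rw [mul_assoc, ih, mul_smul_comm, ← mul_assoc, bvaux_ι_comm q u h hh, smul_mul_assoc,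
      smul_smul, mul_assoc, ← pow_add, Nat.succ_mul]

theorem bvaux_contr_mem {N : ℕ} (k : Fin N) (p : ℕ) (w : ExtN N) (hw : w ∈ grE N p) :
    (p = 0 ∧ contr k w = 0) ∨ ∃ r, p = r + 1 ∧ contr k w ∈ grE N r := by
  unfold grE at hw
  induction hw using Submodule.pow_induction_on_left' with
  | algebraMap r =>
    left
    exact ⟨rfl, CliffordAlgebra.contractLeft_algebraMap _ _ _⟩
  | add x y i hx hy h1 h2 =>
    rcases h1 with ⟨h, h1⟩ | ⟨r, h, h1⟩
    · rcases h2 with ⟨h', h2⟩ | ⟨r', h', h2⟩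
      · left; exact ⟨h, by rw [map_add, h1, h2, add_zero]⟩
      · omega
    · rcases h2 with ⟨h', h2⟩ | ⟨r', h', h2⟩
      · omega
      · right
        obtain rfl : r = r' := by omega
        exact ⟨r, h, by rw [map_add]; exact add_mem h1 h2⟩
  | mem_mul m hm i x hx ih =>
    obtain ⟨v, rfl⟩ := hm
    have key : contr k (ExteriorAlgebra.ι ℂ v * x)
        = (v k) • x - ExteriorAlgebra.ι ℂ v * contr k x :=
      CliffordAlgebra.contractLeft_ι_mul (Q := (0 : QuadraticForm ℂ (Fin N → ℂ)))
        (d := LinearMap.proj k) v x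
    right
    refine ⟨i, rfl, ?_⟩
    rw [key]
    refine sub_mem (Submodule.smul_mem _ _ hx) ?_
    rcases ih with ⟨_, h1⟩ | ⟨r, rfl, h1⟩
    · rw [h1, mul_zero]; exact zero_mem _
    · unfold grE at h1 ⊢
      rw [pow_succ']
      exact Submodule.mul_mem_mul ⟨v, rfl⟩ h1

theorem bvaux_contr_comm {N : ℕ} (k : Fin N) (p q : ℕ) (w : ExtN N) (hw : w ∈ grE N p)
    (h : ExtN N) (hh : h ∈ grE N q) :
    contr k w * h = ((-1 : ℂ) ^ ((p + 1) * q)) • (h * contr k w) := by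
  rcases bvaux_contr_mem k p w hw with ⟨_, h1⟩ | ⟨r, rfl, h1⟩
  · simp [h1]
  · rw [bvaux_comm r q _ h1 h hh]
    congr 1
    rw [show (r + 1 + 1) * q = r * q + 2 * q by ring, pow_add, pow_mul _ 2]
    simp

theorem bvaux_ind {N p : ℕ} {P : (A : PV N) → A ∈ PVgr N p → Prop} (h0 : P 0 (zero_mem _))
    (hadd : ∀ x y mx my, P x mx → P y my → P (x + y) (add_mem mx my))
    (ht : ∀ a w, (hw : w ∈ grE N p) → P (a ⊗ₜ w) ⟨a ⊗ₜ ⟨w, hw⟩, rfl⟩)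
    (A : PV N) (hA : A ∈ PVgr N p) : P A hA := by
  obtain ⟨t, rfl⟩ := hA
  induction t using TensorProduct.induction_on with
  | zero => simpa using h0
  | add x y hx hy => simpa using hadd _ _ _ _ hx hy
  | tmul a w => exact ht a _ w.2

/-- Differentiation of the coefficients. -/
def bvD {N : ℕ} (k : Fin N) : PV N →ₗ[ℂ] PV N :=
  TensorProduct.map (pderiv k).toLinearMap LinearMap.id

/-- Contraction, extended linearly over the coefficients. -/
def bvI {N : ℕ} (k : Fin N) : PV N →ₗ[ℂ] PV N :=
  TensorProduct.map LinearMap.id (contr k)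

theorem bv_eq {N : ℕ} (A : PV N) : bv N A = ∑ k, bvD k (bvI k A) := by
  simp only [bv, LinearMap.sum_apply, bvD, bvI, ← LinearMap.comp_apply, ← TensorProduct.map_comp,
    LinearMap.comp_id, LinearMap.id_comp]

theorem bvDI {N : ℕ} (k : Fin N) (A : PV N) : bvI k (bvD k A) = bvD k (bvI k A) := by
  simp only [bvD, bvI, ← LinearMap.comp_apply, ← TensorProduct.map_comp,
    LinearMap.comp_id, LinearMap.id_comp]

theorem bvD_mul {N : ℕ} (k : Fin N) (A B : PV N) :
    bvD k (A * B) = bvD k A * B + A * bvD k B := by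
  induction A using TensorProduct.induction_on with
  | zero => simp
  | add x y hx hy => simp only [add_mul, map_add, hx, hy]; abel
  | tmul a w =>
    induction B using TensorProduct.induction_on with
    | zero => simp
    | add x y hx hy => simp only [mul_add, map_add, hx, hy]; abel
    | tmul b h =>
      simp only [bvD, Algebra.TensorProduct.tmul_mul_tmul, TensorProduct.map_tmul,
        LinearMap.id_apply, Derivation.coeFn_coe, Derivation.leibniz, smul_eq_mul]
      rw [← TensorProduct.add_tmul, add_comm, mul_comm b]

theorem bvI_mul {N : ℕ} (k : Fin N) (p : ℕ) (A : PV N) (hA : A ∈ PVgr N p) (B : PV N) :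
    bvI k (A * B) = bvI k A * B + ((-1 : ℂ) ^ p) • (A * bvI k B) := by
  induction A, hA using bvaux_ind with
  | h0 => simp
  | hadd x y mx my hx hy => simp only [add_mul, map_add, hx, hy, smul_add]; abel
  | ht a w hw =>
    induction B using TensorProduct.induction_on with
    | zero => simp
    | add x y hx hy => simp only [mul_add, map_add, hx, hy, smul_add]; abel
    | tmul b h =>
      simp only [bvI, Algebra.TensorProduct.tmul_mul_tmul, TensorProduct.map_tmul,
        LinearMap.id_apply, bvaux_mul k p w hw, TensorProduct.tmul_add, TensorProduct.tmul_smul]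

theorem bvD_mem {N : ℕ} (k : Fin N) (p : ℕ) (A : PV N) (hA : A ∈ PVgr N p) :
    bvD k A ∈ PVgr N p := by
  induction A, hA using bvaux_ind with
  | h0 => simp
  | hadd x y mx my hx hy => rw [map_add]; exact add_mem hx hy
  | ht a w hw => exact ⟨pderiv k a ⊗ₜ ⟨w, hw⟩, rfl⟩

theorem bv_comm {N : ℕ} (p q : ℕ) (A : PV N) (hA : A ∈ PVgr N p) (B : PV N)
    (hB : B ∈ PVgr N q) : A * B = ((-1 : ℂ) ^ (p * q)) • (B * A) := by
  induction A, hA using bvaux_ind with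
  | h0 => simp
  | hadd x y mx my hx hy => simp only [add_mul, mul_add, hx, hy, smul_add]
  | ht a w hw =>
    induction B, hB using bvaux_ind with
    | h0 => simp
    | hadd x y mx my hx hy => simp only [add_mul, mul_add, hx, hy, smul_add]
    | ht b h hh =>
      simp only [Algebra.TensorProduct.tmul_mul_tmul]
      rw [bvaux_comm p q w hw h hh, TensorProduct.tmul_smul, mul_comm a]

theorem bvI_comm {N : ℕ} (k : Fin N) (p q : ℕ) (A : PV N) (hA : A ∈ PVgr N p) (B : PV N)
    (hB : B ∈ PVgr N q) : bvI k A * B = ((-1 : ℂ) ^ ((p + 1) * q)) • (B * bvI k A) := by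
  induction A, hA using bvaux_ind with
  | h0 => simp
  | hadd x y mx my hx hy => simp only [add_mul _ _ B, mul_add B, map_add, hx, hy, smul_add]
  | ht a w hw =>
    induction B, hB using bvaux_ind with
    | h0 => simp
    | hadd x y mx my hx hy => simp only [add_mul x y, mul_add _ x y, hx, hy, smul_add]
    | ht b h hh =>
      simp only [bvI, Algebra.TensorProduct.tmul_mul_tmul, TensorProduct.map_tmul,
        LinearMap.id_apply]
      rw [bvaux_contr_comm k p q w hw h hh, TensorProduct.tmul_smul, mul_comm a]

theorem bvBracket_eq {N : ℕ} (p : ℕ) (A : PV N) (hA : A ∈ PVgr N p) (B : PV N) :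
    bvBracket p A B = ∑ k, (((-1 : ℂ) ^ p) • (bvI k A * bvD k B) + bvD k A * bvI k B) := by
  have hs : ((-1 : ℂ) ^ p) * ((-1 : ℂ) ^ p) = 1 := by
    rw [← mul_pow]; simp
  simp only [bvBracket, bv_eq, Finset.sum_mul, Finset.mul_sum, Finset.smul_sum,
    ← Finset.sum_sub_distrib]
  refine Finset.sum_congr rfl fun k _ => ?_
  rw [bvI_mul k p A hA, map_add, map_smul, bvD_mul, bvD_mul]
  simp only [smul_add, smul_smul, hs, one_smul]
  abel

/-- The BV operator is a second-order operator with respect to the wedge product: the BV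
bracket satisfies the graded Leibniz rule
`{A, B∧C} = {A,B}∧C + (−1)^{(p+1)q} B∧{A,C}` for homogeneous `A ∈ PV^p`, `B ∈ PV^q` and
any `C ∈ PV`. -/
theorem bvBracket_leibniz (N : ℕ) (hN : 0 < N) (p q : ℕ)
    (A : PV N) (hA : A ∈ PVgr N p) (B : PV N) (hB : B ∈ PVgr N q) (C : PV N) :
    bvBracket p A (B * C) =
      bvBracket p A B * C + ((-1 : ℂ) ^ ((p + 1) * q)) • (B * bvBracket p A C) := by

  rw [bvBracket_eq p A hA, bvBracket_eq p A hA, bvBracket_eq p A hA]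
  simp only [Finset.sum_mul, Finset.mul_sum, Finset.smul_sum, ← Finset.sum_add_distrib]
  refine Finset.sum_congr rfl fun k _ => ?_
  have h1 := bvI_comm k p q A hA B hB
  have h2 := bv_comm p q _ (bvD_mem k p A hA) B hB
  have e1 : bvI k A * (B * bvD k C)
      = ((-1 : ℂ) ^ ((p + 1) * q)) • (B * (bvI k A * bvD k C)) := by
    rw [← mul_assoc, h1, smul_mul_assoc, mul_assoc]
  have e2 : ((-1 : ℂ) ^ q) • (bvD k A * (B * bvI k C))
      = ((-1 : ℂ) ^ ((p + 1) * q)) • (B * (bvD k A * bvI k C)) := by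
    rw [← mul_assoc, h2, smul_mul_assoc, mul_assoc, smul_smul, ← pow_add]
    congr 2; ring
  rw [bvD_mul, bvI_mul k q B hB]
  generalize (-1 : ℂ) ^ ((p + 1) * q) = s at e1 e2 ⊢
  simp only [mul_add, add_mul, smul_add, mul_smul_comm, smul_mul_assoc]
  rw [e1, e2, smul_comm ((-1 : ℂ) ^ p) s]
  simp only [mul_assoc]
  abel
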